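/- Let (B_t) be standard one-dimensional Brownian motion started at y ∈ (a,b), and let τ_{a,b} = inf{t ≥ 0 : B_t ∉ (a,b)}. For ρ > 0, E_y[e^{−ρ τ_{a,b}}] = cosh(√(2ρ)(y − (a+b)/2)) / cosh(√(2ρ)(b−a)/2). -/

import Mathlib

open Real MeasureTheory ProbabilityTheory

/-- A standard one-dimensional Brownian motion started at `y`, on a probability space. -/
structure IsBrownianMotion {Ω : Type*} [MeasureSpace Ω] (B : ℝ → Ω → ℝ) (y : ℝ) : Prop where
  isProb : IsProbabilityMeasure (volume : Measure Ω)
  meas : ∀ t, Measurable (B t)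
  cont : ∀ ω, Continuous fun t => B t ω
  start : ∀ ω, B 0 ω = y
  gauss_incr : ∀ s t : ℝ, 0 ≤ s → s ≤ t →
    Measure.map (fun ω => B t ω - B s ω) volume = gaussianReal 0 (t - s).toNNReal
  indep_incr : ∀ s t : ℝ, 0 ≤ s → s ≤ t →
    IndepFun (fun ω => (fun u : Set.Icc (0:ℝ) s => B u ω)) (fun ω => B t ω - B s ω) volume

/-- First hitting time of the level `c` (for nonnegative times). -/
noncomputable def hitTime {Ω : Type*} (B : ℝ → Ω → ℝ) (c : ℝ) (ω : Ω) : ℝ :=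
  sInf {t : ℝ | 0 ≤ t ∧ B t ω = c}

/-- Exit time from the open interval `(a, b)`. -/
noncomputable def exitTime {Ω : Type*} (B : ℝ → Ω → ℝ) (a b : ℝ) (ω : Ω) : ℝ :=
  sInf {t : ℝ | 0 ≤ t ∧ B t ω ∉ Set.Ioo a b}

open scoped NNReal Topology
open Filter

/-- Facts about the first exit time when the path does exit. -/
lemma exit_facts {Ω : Type*} {B : ℝ → Ω → ℝ} {a b : ℝ} {ω : Ω}
    (hc : Continuous fun t => B t ω) (h0 : B 0 ω ∈ Set.Ioo a b)
    (hne : ∃ s, 0 ≤ s ∧ B s ω ∉ Set.Ioo a b) :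
    0 ≤ exitTime B a b ω ∧ (B (exitTime B a b ω) ω = a ∨ B (exitTime B a b ω) ω = b) ∧
    (∀ s, 0 ≤ s → B s ω ∉ Set.Ioo a b → exitTime B a b ω ≤ s) := by
  set E : Set ℝ := {t : ℝ | 0 ≤ t ∧ B t ω ∉ Set.Ioo a b} with hE
  have hcl : IsClosed E := by
    have : E = Set.Ici 0 ∩ ((fun t => B t ω) ⁻¹' (Set.Ioo a b)ᶜ) := by
      ext t; simp [hE]
    rw [this]
    exact isClosed_Ici.inter ((isOpen_Ioo.isClosed_compl).preimage hc)
  have hbd : BddBelow E := ⟨0, fun t ht => ht.1⟩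
  have hEne : E.Nonempty := hne
  have hmem : exitTime B a b ω ∈ E := hcl.csInf_mem hEne hbd
  have hle : ∀ s, 0 ≤ s → B s ω ∉ Set.Ioo a b → exitTime B a b ω ≤ s :=
    fun s h1 h2 => csInf_le hbd ⟨h1, h2⟩
  refine ⟨hmem.1, ?_, hle⟩
  set e := exitTime B a b ω
  have hpos : 0 < e := by
    rcases hmem.1.lt_or_eq with h | h
    · exact h
    · exact absurd (h ▸ h0) hmem.2
  have hIcc : B e ω ∈ Set.Icc a b := by
    have h1 : Tendsto (fun t => B t ω) (𝓝[<] e) (𝓝 (B e ω)) :=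
      (hc.tendsto e).mono_left nhdsWithin_le_nhds
    refine isClosed_Icc.mem_of_tendsto h1 ?_
    filter_upwards [Ioo_mem_nhdsLT hpos] with t ht
    by_contra hcon
    have := hle t ht.1.le (fun h => hcon (Set.Ioo_subset_Icc_self h))
    linarith [ht.2]
  have h2 := hmem.2
  simp only [Set.mem_Ioo, not_and_or, not_lt] at h2
  rcases h2 with h | h
  · left; linarith [hIcc.1]
  · right; linarith [hIcc.2]

open Classical in
/-- The truncated exit time. -/
noncomputable def truncExit {Ω : Type*} (B : ℝ → Ω → ℝ) (a b : ℝ) (T : ℝ≥0) (ω : Ω) : ℝ≥0 :=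
  if ∃ s : ℝ, (0 ≤ s ∧ s ≤ T) ∧ B s ω ∉ Set.Ioo a b then (exitTime B a b ω).toNNReal else T

lemma truncExit_le {Ω : Type*} {B : ℝ → Ω → ℝ} {a b : ℝ} {ω : Ω}
    (hc : Continuous fun t => B t ω) (h0 : B 0 ω ∈ Set.Ioo a b) (T : ℝ≥0) :
    truncExit B a b T ω ≤ T := by
  unfold truncExit
  split_ifs with h
  · obtain ⟨s, ⟨h1, h2⟩, h3⟩ := h
    have := (exit_facts hc h0 ⟨s, h1, h3⟩).2.2 s h1 h3
    exact Real.toNNReal_le_iff_le_coe.2 (this.trans h2)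
  · exact le_rfl

lemma truncExit_le_iff {Ω : Type*} {B : ℝ → Ω → ℝ} {a b : ℝ} {ω : Ω}
    (hc : Continuous fun t => B t ω) (h0 : B 0 ω ∈ Set.Ioo a b) {T q : ℝ≥0} (hq : q < T) :
    truncExit B a b T ω ≤ q ↔ ∃ s : ℝ, (0 ≤ s ∧ s ≤ q) ∧ B s ω ∉ Set.Ioo a b := by
  constructor
  · intro h
    unfold truncExit at h
    split_ifs at h with h'
    · obtain ⟨s, ⟨h1, h2⟩, h3⟩ := h'
      obtain ⟨e0, e1, e2⟩ := exit_facts hc h0 ⟨s, h1, h3⟩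
      refine ⟨exitTime B a b ω, ⟨e0, Real.toNNReal_le_iff_le_coe.1 h⟩, ?_⟩
      rcases e1 with e1 | e1 <;> rw [e1] <;> simp
    · exact absurd h (not_le.2 hq)
  · rintro ⟨s, ⟨h1, h2⟩, h3⟩
    have hqT : (q : ℝ) ≤ T := by exact_mod_cast hq.le
    unfold truncExit
    rw [if_pos ⟨s, ⟨h1, h2.trans hqT⟩, h3⟩]
    exact Real.toNNReal_le_iff_le_coe.2 (((exit_facts hc h0 ⟨s, h1, h3⟩).2.2 s h1 h3).trans h2)

lemma truncExit_mem {Ω : Type*} {B : ℝ → Ω → ℝ} {a b : ℝ} {ω : Ω}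
    (hc : Continuous fun t => B t ω) (h0 : B 0 ω ∈ Set.Ioo a b) (T : ℝ≥0) :
    B (truncExit B a b T ω) ω ∈ Set.Icc a b := by
  have hab : a ≤ b := (h0.1.trans h0.2).le
  unfold truncExit
  split_ifs with h
  · obtain ⟨s, ⟨h1, h2⟩, h3⟩ := h
    obtain ⟨e0, e1, e2⟩ := exit_facts hc h0 ⟨s, h1, h3⟩
    rw [Real.coe_toNNReal _ e0]
    rcases e1 with e1 | e1 <;> rw [e1] <;> simp [hab]
  · push Not at h
    exact Set.Ioo_subset_Icc_self (h T ⟨T.2, le_rfl⟩)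

/-- The filtration generated by the past of the process. -/
def pastFilt {Ω : Type*} [m : MeasurableSpace Ω] (B : ℝ → Ω → ℝ) (hB : ∀ t, Measurable (B t)) :
    Filtration ℝ≥0 m where
  seq i := MeasurableSpace.comap (fun ω => (fun u : Set.Icc (0:ℝ) i => B u ω)) inferInstance
  mono' := by
    intro i j hij
    have hij' : (i : ℝ) ≤ j := by exact_mod_cast hij
    have hm : Measurable (fun (f : Set.Icc (0:ℝ) j → ℝ) (u : Set.Icc (0:ℝ) i) =>
        f ⟨u, u.2.1, u.2.2.trans hij'⟩) := by
      fun_prop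
    simp only
    rintro s ⟨t, ht, rfl⟩
    exact ⟨_, hm ht, rfl⟩
  le' i := by
    rw [← measurable_iff_comap_le]
    exact measurable_pi_lambda _ fun u => hB u

lemma pastFilt_meas {Ω : Type*} [m : MeasurableSpace Ω] (B : ℝ → Ω → ℝ)
    (hB : ∀ t, Measurable (B t)) (i : ℝ≥0) (u : ℝ) (hu : 0 ≤ u) (hui : u ≤ i) :
    Measurable[pastFilt B hB i] (B u) := by
  have h1 : Measurable (fun f : Set.Icc (0:ℝ) i → ℝ => f ⟨u, hu, hui⟩) := measurable_pi_apply _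
  exact h1.comp (comap_measurable _)

lemma meas_exit {Ω : Type*} [m : MeasurableSpace Ω] (B : ℝ → Ω → ℝ)
    (hB : ∀ t, Measurable (B t)) (hc : ∀ ω, Continuous fun t => B t ω) (a b : ℝ) (t : ℝ≥0) :
    MeasurableSet[pastFilt B hB t] {ω | ∃ s : ℝ, (0 ≤ s ∧ s ≤ t) ∧ B s ω ∉ Set.Ioo a b} := by
  have : Nonempty (Set.Icc (0:ℝ) t) := ⟨⟨0, le_rfl, t.2⟩⟩
  have key : {ω | ∃ s : ℝ, (0 ≤ s ∧ s ≤ t) ∧ B s ω ∉ Set.Ioo a b} =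
      ⋂ n : ℕ, ⋃ k : ℕ, {ω | min (B (TopologicalSpace.denseSeq (Set.Icc (0:ℝ) t) k) ω - a)
        (b - B (TopologicalSpace.denseSeq (Set.Icc (0:ℝ) t) k) ω) < 1 / ((n : ℝ) + 1)} := by
    ext ω
    have hcont : Continuous (fun u : Set.Icc (0:ℝ) t => min (B u ω - a) (b - B u ω)) := by
      have := (hc ω).comp (continuous_subtype_val (p := fun x => x ∈ Set.Icc (0:ℝ) t))
      exact (this.sub continuous_const).min (continuous_const.sub this)
    have hiff : ∀ x : ℝ, x ∉ Set.Ioo a b ↔ min (x - a) (b - x) ≤ 0 := by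
      intro x; rw [Set.mem_Ioo, not_and_or, min_le_iff]; simp
    simp only [Set.mem_ofPred_eq, Set.mem_iInter, Set.mem_iUnion, hiff]
    constructor
    · rintro ⟨s, hs, h⟩ n
      have hop : IsOpen {u : Set.Icc (0:ℝ) t | min (B u ω - a) (b - B u ω) < 1 / ((n : ℝ) + 1)} :=
        isOpen_lt hcont continuous_const
      obtain ⟨x, hx, k, rfl⟩ := (TopologicalSpace.denseRange_denseSeq (Set.Icc (0:ℝ) t)).inter_open_nonempty
        _ hop ⟨⟨s, hs⟩, lt_of_le_of_lt h (by positivity)⟩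
      exact ⟨k, hx⟩
    · intro h
      obtain ⟨u, -, hu⟩ := isCompact_univ.exists_isMinOn Set.univ_nonempty hcont.continuousOn
      refine ⟨u, u.2, ?_⟩
      refine le_of_forall_pos_le_add fun ε hε => ?_
      obtain ⟨n, hn⟩ := exists_nat_one_div_lt hε
      obtain ⟨k, hk⟩ := h n
      have := isMinOn_iff.1 hu _ (Set.mem_univ (TopologicalSpace.denseSeq (Set.Icc (0:ℝ) t) k))
      linarith
  rw [key]
  refine MeasurableSet.iInter fun n => MeasurableSet.iUnion fun k => ?_
  have hm := pastFilt_meas B hB t (TopologicalSpace.denseSeq (Set.Icc (0:ℝ) t) k)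
    (TopologicalSpace.denseSeq (Set.Icc (0:ℝ) t) k).2.1
    (TopologicalSpace.denseSeq (Set.Icc (0:ℝ) t) k).2.2
  exact measurableSet_lt ((hm.sub measurable_const).min (measurable_const.sub hm)) measurable_const

/-- Discretization from above of the truncated exit time. -/
noncomputable def discExit {Ω : Type*} (B : ℝ → Ω → ℝ) (a b : ℝ) (T : ℝ≥0) (n : ℕ) (ω : Ω) : ℝ≥0 :=
  min ((⌈truncExit B a b T ω * ((n : ℝ≥0) + 1)⌉₊ : ℝ≥0) / ((n : ℝ≥0) + 1)) T

lemma discExit_stopping {Ω : Type*} [m : MeasurableSpace Ω] (B : ℝ → Ω → ℝ)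
    (hB : ∀ t, Measurable (B t)) (hc : ∀ ω, Continuous fun t => B t ω) (a b : ℝ)
    (h0 : ∀ ω, B 0 ω ∈ Set.Ioo a b) (T : ℝ≥0) (n : ℕ) :
    IsStoppingTime (pastFilt B hB) (fun ω => (discExit B a b T n ω : WithTop ℝ≥0)) := by
  intro t
  by_cases htT : T ≤ t
  · convert MeasurableSet.univ
    ext ω
    simp only [Set.mem_ofPred_eq, Set.mem_univ, iff_true, WithTop.coe_le_coe]
    exact (min_le_right _ _).trans htT
  · push Not at htT
    have hn : (0 : ℝ≥0) < (n : ℝ≥0) + 1 := by positivity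
    set q : ℝ≥0 := (⌊t * ((n : ℝ≥0) + 1)⌋₊ : ℝ≥0) / ((n : ℝ≥0) + 1) with hq
    have hqt : q ≤ t := by
      rw [hq, div_le_iff₀ hn]
      exact Nat.floor_le (zero_le)
    have : {ω | (discExit B a b T n ω : WithTop ℝ≥0) ≤ t} =
        {ω | ∃ s : ℝ, (0 ≤ s ∧ s ≤ q) ∧ B s ω ∉ Set.Ioo a b} := by
      ext ω
      simp only [Set.mem_ofPred_eq, WithTop.coe_le_coe]
      rw [← truncExit_le_iff (hc ω) (h0 ω) (hqt.trans_lt htT)]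
      unfold discExit
      rw [min_le_iff, or_iff_left (not_le.2 htT), div_le_iff₀ hn, ← Nat.le_floor_iff (zero_le),
        Nat.ceil_le, hq, le_div_iff₀ hn]
    rw [this]
    exact (pastFilt B hB).mono hqt _ (meas_exit B hB hc a b q)

lemma discExit_countable {Ω : Type*} (B : ℝ → Ω → ℝ) (a b : ℝ) (T : ℝ≥0) (n : ℕ) :
    (Set.range (fun ω => (discExit B a b T n ω : WithTop ℝ≥0))).Countable := by
  refine (Set.countable_range (fun k : ℕ =>
    ((min ((k : ℝ≥0) / ((n : ℝ≥0) + 1)) T : ℝ≥0) : WithTop ℝ≥0))).mono ?_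
  rintro _ ⟨ω, rfl⟩
  exact ⟨_, rfl⟩

lemma discExit_tendsto {Ω : Type*} {B : ℝ → Ω → ℝ} {a b : ℝ} {ω : Ω}
    (hc : Continuous fun t => B t ω) (h0 : B 0 ω ∈ Set.Ioo a b) (T : ℝ≥0) :
    Tendsto (fun n => discExit B a b T n ω) atTop (𝓝 (truncExit B a b T ω)) := by
  set S := truncExit B a b T ω with hS
  have hST : S ≤ T := truncExit_le hc h0 T
  have hlim : Tendsto (fun n : ℕ => S + 1 / ((n : ℝ≥0) + 1)) atTop (𝓝 S) := by
    have : Tendsto (fun n : ℕ => 1 / ((n : ℝ≥0) + 1)) atTop (𝓝 0) := by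
      exact tendsto_one_div_add_atTop_nhds_zero_nat
    simpa using tendsto_const_nhds.add this
  refine tendsto_of_tendsto_of_tendsto_of_le_of_le tendsto_const_nhds hlim ?_ ?_
  · intro n
    have hn : (0 : ℝ≥0) < (n : ℝ≥0) + 1 := by positivity
    refine le_min ?_ hST
    rw [le_div_iff₀ hn]
    exact Nat.le_ceil _
  · intro n
    have hn : (0 : ℝ≥0) < (n : ℝ≥0) + 1 := by positivity
    refine (min_le_left _ _).trans ?_
    rw [div_le_iff₀ hn, add_mul, one_div, inv_mul_cancel₀ hn.ne']
    exact (Nat.ceil_lt_add_one (zero_le)).le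

lemma expMart {Ω : Type*} [MeasureSpace Ω] {B : ℝ → Ω → ℝ} {y : ℝ} (hB : IsBrownianMotion B y)
    (c p ρ : ℝ) (hc : c ^ 2 = 2 * ρ) :
    Martingale (fun (t : ℝ≥0) ω => Real.exp (c * (B t ω - p) - ρ * t)) (pastFilt B hB.meas)
      (volume : Measure Ω) := by
  have := hB.isProb
  have hint : ∀ s t : ℝ, 0 ≤ s → s ≤ t → Integrable (fun ω => Real.exp (c * (B t ω - B s ω))) := by
    intro s t hs hst
    have h1 : Integrable (fun x ↦ rexp (c * x)) (gaussianReal 0 (t - s).toNNReal) :=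
      integrable_exp_mul_gaussianReal c
    rw [← hB.gauss_incr s t hs hst] at h1
    exact h1.comp_measurable ((hB.meas t).sub (hB.meas s))
  have hM : ∀ t : ℝ≥0, Integrable (fun ω => Real.exp (c * (B t ω - p) - ρ * t)) := by
    intro t
    have h1 := (hint 0 t le_rfl t.2).mul_const (Real.exp (c * (y - p) - ρ * t))
    refine h1.congr (ae_of_all _ fun ω => ?_)
    simp only [hB.start]
    rw [← Real.exp_add]
    ring_nf
  have hmeas : ∀ t : ℝ≥0, StronglyMeasurable[pastFilt B hB.meas t]
      (fun ω => Real.exp (c * (B t ω - p) - ρ * t)) := by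
    intro t
    have h1 := pastFilt_meas B hB.meas t t t.2 le_rfl
    exact Measurable.stronglyMeasurable
      (Real.measurable_exp.comp (((h1.sub measurable_const).const_mul c).sub measurable_const))
  refine ⟨hmeas, ?_⟩
  intro s t hst
  have hst' : (s : ℝ) ≤ t := by exact_mod_cast hst
  set X : Ω → ℝ := fun ω => B t ω - B s ω with hX
  set Y : Ω → ℝ := fun ω => Real.exp (c * X ω - ρ * (t - s)) with hY
  have hYint : Integrable Y := by
    have h1 := (hint s t s.2 hst').mul_const (Real.exp (- (ρ * (t - s))))
    refine h1.congr (ae_of_all _ fun ω => ?_)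
    simp only [hY, hX]
    rw [← Real.exp_add]
    ring_nf
  have hprod : (fun ω => Real.exp (c * (B t ω - p) - ρ * t)) =
      (fun ω => Real.exp (c * (B s ω - p) - ρ * s)) * Y := by
    funext ω
    simp only [Pi.mul_apply, hY, hX]
    rw [← Real.exp_add]
    ring_nf
  have hE : ∫ ω, Y ω = 1 := by
    have h1 : mgf X volume c = _ := mgf_gaussianReal (hB.gauss_incr s t s.2 hst') c
    have h2 : ∫ ω, Y ω = mgf X volume c * Real.exp (-(ρ * (t - s))) := by
      unfold mgf
      rw [← integral_mul_const]
      congr 1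
      funext ω
      simp only [hY]
      rw [← Real.exp_add]
      ring_nf
    rw [h2, h1, ← Real.exp_add, Real.coe_toNNReal _ (sub_nonneg.2 hst'), hc, Real.exp_eq_one_iff]
    ring
  have hYm : StronglyMeasurable[MeasurableSpace.comap X inferInstance] Y := by
    have : Measurable[MeasurableSpace.comap X inferInstance] X := comap_measurable _
    exact Measurable.stronglyMeasurable
      (Real.measurable_exp.comp ((this.const_mul c).sub measurable_const))
  have hXm : Measurable X := (hB.meas t).sub (hB.meas s)
  have hcond : (volume : Measure Ω)[Y | pastFilt B hB.meas s] =ᵐ[volume] fun _ => ∫ ω, Y ω := by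
    refine condExp_indep_eq (measurable_iff_comap_le.1 hXm) ((pastFilt B hB.meas).le s) hYm ?_
    exact ((IndepFun_iff_Indep _ _ _).1 (hB.indep_incr s t s.2 hst')).symm
  have hpull := condExp_mul_of_stronglyMeasurable_left (μ := (volume : Measure Ω)) (hmeas s) (g := Y)
    (by rw [← hprod]; exact hM t) hYint
  rw [← hprod] at hpull
  filter_upwards [hpull, hcond] with ω h1 h2
  rw [h1, Pi.mul_apply, h2, hE, mul_one]

lemma coshMart {Ω : Type*} [MeasureSpace Ω] {B : ℝ → Ω → ℝ} {y : ℝ} (hB : IsBrownianMotion B y)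
    (c p ρ : ℝ) (hc : c ^ 2 = 2 * ρ) :
    Martingale (fun (t : ℝ≥0) ω => Real.cosh (c * (B t ω - p)) * Real.exp (-ρ * t))
      (pastFilt B hB.meas) (volume : Measure Ω) := by
  have h1 := expMart hB c p ρ hc
  have h2 := expMart hB (-c) p ρ (by rw [neg_sq, hc])
  have h3 := (h1.add h2).smul (1 / 2 : ℝ)
  convert h3 using 1
  funext t ω
  simp only [Pi.smul_apply, Pi.add_apply, smul_eq_mul]
  rw [Real.cosh_eq, sub_eq_add_neg (c * (B t ω - p)), sub_eq_add_neg (-c * (B t ω - p)),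
    Real.exp_add, Real.exp_add, neg_mul, neg_mul]
  ring

lemma exit_ae {Ω : Type*} [MeasureSpace Ω] {B : ℝ → Ω → ℝ} {y : ℝ} (hB : IsBrownianMotion B y)
    (a b : ℝ) : ∀ᵐ ω : Ω, ∃ s, 0 ≤ s ∧ B s ω ∉ Set.Ioo a b := by
  have := hB.isProb
  rw [ae_iff]
  have hbound : ∀ n : ℕ, volume {ω : Ω | ¬ ∃ s, 0 ≤ s ∧ B s ω ∉ Set.Ioo a b} ≤
      ENNReal.ofReal ((√(2 * π * ((n : ℝ) + 1)))⁻¹) * ENNReal.ofReal ((b - y) - (a - y)) := by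
    intro n
    have hn : (0 : ℝ) ≤ (n : ℝ) + 1 := by positivity
    have hv : ((n : ℝ) + 1 - 0).toNNReal ≠ 0 := by
      simp only [ne_eq, Real.toNNReal_eq_zero, not_le]; linarith [(Nat.cast_nonneg n : (0:ℝ) ≤ n)]
    calc volume {ω : Ω | ¬ ∃ s, 0 ≤ s ∧ B s ω ∉ Set.Ioo a b}
        ≤ volume ((fun ω => B ((n : ℝ) + 1) ω - B 0 ω) ⁻¹' (Set.Ioo (a - y) (b - y))) := by
          refine measure_mono fun ω hω => ?_
          simp only [Set.mem_ofPred_eq, not_exists, not_and, not_not] at hω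
          have := hω _ hn
          simp only [Set.mem_preimage, hB.start, Set.mem_Ioo]
          exact ⟨by linarith [this.1], by linarith [this.2]⟩
      _ = gaussianReal 0 ((n : ℝ) + 1 - 0).toNNReal (Set.Ioo (a - y) (b - y)) := by
          rw [← hB.gauss_incr 0 _ le_rfl hn]
          exact (Measure.map_apply ((hB.meas _).sub (hB.meas _)) measurableSet_Ioo).symm
      _ = ∫⁻ x in Set.Ioo (a - y) (b - y), gaussianPDF 0 ((n : ℝ) + 1 - 0).toNNReal x :=
          gaussianReal_apply _ hv _
      _ ≤ ∫⁻ x in Set.Ioo (a - y) (b - y), ENNReal.ofReal ((√(2 * π * ((n : ℝ) + 1)))⁻¹) := by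
          refine lintegral_mono fun x => ?_
          unfold gaussianPDF gaussianPDFReal
          refine ENNReal.ofReal_le_ofReal ?_
          rw [Real.coe_toNNReal _ (by simpa using hn), sub_zero]
          refine mul_le_of_le_one_right (by positivity) ?_
          rw [Real.exp_le_one_iff]
          exact div_nonpos_of_nonpos_of_nonneg (by nlinarith [sq_nonneg (x - 0)]) (by positivity)
      _ = _ := by
          rw [setLIntegral_const, Real.volume_Ioo]
  have hlim : Tendsto (fun n : ℕ => ENNReal.ofReal ((√(2 * π * ((n : ℝ) + 1)))⁻¹) *
      ENNReal.ofReal ((b - y) - (a - y))) atTop (𝓝 0) := by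
    have h1 : Tendsto (fun n : ℕ => (√(2 * π * ((n : ℝ) + 1)))⁻¹) atTop (𝓝 0) := by
      refine tendsto_inv_atTop_zero.comp (Real.tendsto_sqrt_atTop.comp ?_)
      exact (tendsto_atTop_add_const_right _ _ tendsto_natCast_atTop_atTop).const_mul_atTop
        (by positivity)
    have h2 := ENNReal.tendsto_ofReal h1
    have h3 := ENNReal.Tendsto.mul_const (b := ENNReal.ofReal ((b - y) - (a - y))) h2
      (Or.inr ENNReal.ofReal_ne_top)
    simpa using h3
  exact le_antisymm (ge_of_tendsto' hlim hbound) (zero_le)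

lemma cosh_le_of_mem {a b c x : ℝ} (hx : x ∈ Set.Icc a b) :
    Real.cosh (c * (x - (a + b) / 2)) ≤ Real.cosh (c * (b - a) / 2) := by
  rw [Real.cosh_le_cosh, mul_div_assoc, abs_mul, abs_mul]
  refine mul_le_mul_of_nonneg_left ?_ (abs_nonneg c)
  rw [abs_of_nonneg (a := (b - a) / 2) (by linarith [hx.1, hx.2]), abs_le]
  constructor <;> linarith [hx.1, hx.2]

/-- Optional stopping at the truncated exit time. -/
lemma stopped_integral {Ω : Type*} [MeasureSpace Ω] {B : ℝ → Ω → ℝ} {a b y ρ c : ℝ}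
    (hy : y ∈ Set.Ioo a b) (hρ : 0 < ρ) (hB : IsBrownianMotion B y) (hc : c ^ 2 = 2 * ρ)
    (T : ℝ≥0) :
    AEStronglyMeasurable (fun ω => Real.cosh (c * (B (truncExit B a b T ω) ω - (a + b) / 2)) *
      Real.exp (-ρ * truncExit B a b T ω)) (volume : Measure Ω) ∧
    ∫ ω, Real.cosh (c * (B (truncExit B a b T ω) ω - (a + b) / 2)) *
      Real.exp (-ρ * truncExit B a b T ω) = Real.cosh (c * (y - (a + b) / 2)) := by
  have := hB.isProb
  have h0 : ∀ ω, B 0 ω ∈ Set.Ioo a b := fun ω => by rw [hB.start]; exact hy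
  have hmart := coshMart hB c ((a + b) / 2) ρ hc
  set M : ℝ≥0 → Ω → ℝ :=
    fun (t : ℝ≥0) ω => Real.cosh (c * (B t ω - (a + b) / 2)) * Real.exp (-ρ * t) with hM
  set G : Ω → ℝ := fun ω => M (truncExit B a b T ω) ω with hG
  change AEStronglyMeasurable G volume ∧ ∫ ω, G ω = _
  have hst := discExit_stopping B hB.meas hB.cont a b h0 T
  have hle : ∀ n ω, (discExit B a b T n ω : WithTop ℝ≥0) ≤ T := fun n ω =>
    WithTop.coe_le_coe.2 (min_le_right _ _)
  have hae : ∀ n, (fun ω => M (discExit B a b T n ω) ω) =ᵐ[volume]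
      (volume : Measure Ω)[M T | (hst n).measurableSpace] := fun n =>
    hmart.stoppedValue_ae_eq_condExp_of_le_const_of_countable_range (hst n) (hle n)
      (discExit_countable B a b T n)
  have hsub : ∀ n, (hst n).measurableSpace ≤ (inferInstance : MeasurableSpace Ω) := fun n =>
    (hst n).measurableSpace_le
  have hUI := (hmart.integrable T).uniformIntegrable_condExp hsub
  have hconv : ∀ᵐ ω : Ω, Tendsto
      (fun n => ((volume : Measure Ω)[M T | (hst n).measurableSpace]) ω) atTop (𝓝 (G ω)) := by
    filter_upwards [ae_all_iff.2 hae] with ω hω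
    simp_rw [← hω]
    have hcont : Continuous fun t : ℝ≥0 => M t ω := by
      have h1 : Continuous fun t : ℝ≥0 => B t ω := (hB.cont ω).comp NNReal.continuous_coe
      exact (Real.continuous_cosh.comp ((h1.sub continuous_const).const_mul c)).mul
        (Real.continuous_exp.comp (NNReal.continuous_coe.const_mul (-ρ)))
    exact (hcont.tendsto _).comp (discExit_tendsto (hB.cont ω) (h0 ω) T)
  have hGm : AEStronglyMeasurable G (volume : Measure Ω) :=
    aestronglyMeasurable_of_tendsto_ae atTop (fun n => hUI.1 n) hconv
  refine ⟨hGm, ?_⟩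
  have hGb : ∀ ω, ‖G ω‖ ≤ Real.cosh (c * (b - a) / 2) := by
    intro ω
    have h1 := cosh_le_of_mem (c := c) (truncExit_mem (hB.cont ω) (h0 ω) T)
    have h2 : Real.exp (-ρ * truncExit B a b T ω) ≤ 1 := by
      rw [Real.exp_le_one_iff]
      nlinarith [(truncExit B a b T ω).2, mul_nonneg hρ.le (truncExit B a b T ω).2]
    have h3 : 0 ≤ G ω := mul_nonneg (Real.cosh_pos _).le (Real.exp_pos _).le
    rw [Real.norm_of_nonneg h3]
    exact (mul_le_of_le_one_right (Real.cosh_pos _).le h2).trans h1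
  have hGL : MemLp G 1 (volume : Measure Ω) := MemLp.of_bound hGm _ (ae_of_all _ hGb)
  have hL1 := tendsto_Lp_finite_of_tendsto_ae le_rfl ENNReal.one_ne_top (fun n => hUI.1 n) hGL
    hUI.2.1 hconv
  have hI := tendsto_integral_of_L1' G hGm (Eventually.of_forall fun n => integrable_condExp) hL1
  have hconst : ∀ n, ∫ ω, ((volume : Measure Ω)[M T | (hst n).measurableSpace]) ω =
      Real.cosh (c * (y - (a + b) / 2)) := by
    intro n
    rw [integral_condExp (hsub n)]
    have h1 := hmart.setIntegral_eq (zero_le : (0 : ℝ≥0) ≤ T) (MeasurableSet.univ)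
    simp only [setIntegral_univ] at h1
    rw [← h1]
    simp [hM, hB.start]
  simp_rw [hconst] at hI
  exact (tendsto_nhds_unique hI tendsto_const_nhds)

theorem stmt_13 {Ω : Type*} [MeasureSpace Ω] (B : ℝ → Ω → ℝ) (a b y ρ : ℝ)
    (hy : y ∈ Set.Ioo a b) (hρ : 0 < ρ) (hB : IsBrownianMotion B y) :
    ∫ ω, Real.exp (-ρ * exitTime B a b ω) =
      Real.cosh (Real.sqrt (2 * ρ) * (y - (a + b) / 2)) /
        Real.cosh (Real.sqrt (2 * ρ) * (b - a) / 2) := by 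
  have := hB.isProb
  have h0 : ∀ ω, B 0 ω ∈ Set.Ioo a b := fun ω => by rw [hB.start]; exact hy
  set c := Real.sqrt (2 * ρ) with hcdef
  have hc : c ^ 2 = 2 * ρ := Real.sq_sqrt (by positivity)
  have hK : 0 < Real.cosh (c * (b - a) / 2) := Real.cosh_pos _
  rw [eq_div_iff hK.ne', ← integral_mul_const]
  have hst := fun T : ℕ => stopped_integral hy hρ hB hc (T : ℝ≥0)
  have hlim := tendsto_integral_of_dominated_convergence (μ := (volume : Measure Ω))
    (F := fun (T : ℕ) ω => Real.cosh (c * (B (truncExit B a b T ω) ω - (a + b) / 2)) *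
      Real.exp (-ρ * truncExit B a b T ω))
    (f := fun ω => Real.exp (-ρ * exitTime B a b ω) * Real.cosh (c * (b - a) / 2))
    (fun _ => Real.cosh (c * (b - a) / 2)) (fun n => (hst n).1) (integrable_const _)
    (fun n => ae_of_all _ fun ω => by
      have h1 := cosh_le_of_mem (c := c) (truncExit_mem (hB.cont ω) (h0 ω) n)
      have h2 : Real.exp (-ρ * truncExit B a b n ω) ≤ 1 := by
        rw [Real.exp_le_one_iff]
        nlinarith [(truncExit B a b n ω).2, mul_nonneg hρ.le (truncExit B a b n ω).2]
      rw [Real.norm_of_nonneg (mul_nonneg (Real.cosh_pos _).le (Real.exp_pos _).le)]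
      exact (mul_le_of_le_one_right (Real.cosh_pos _).le h2).trans h1)
    (by
      filter_upwards [exit_ae hB a b] with ω hω
      obtain ⟨e0, e1, -⟩ := exit_facts (hB.cont ω) (h0 ω) hω
      obtain ⟨s, hs0, hs⟩ := hω
      refine tendsto_const_nhds.congr' ?_
      filter_upwards [eventually_ge_atTop ⌈s⌉₊] with n hn
      have hsn : s ≤ n := (Nat.le_ceil s).trans (by exact_mod_cast hn)
      have hS : (truncExit B a b n ω : ℝ) = exitTime B a b ω := by
        unfold truncExit
        rw [if_pos ⟨s, ⟨hs0, by simpa using hsn⟩, hs⟩, Real.coe_toNNReal _ e0]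
      rw [hS, mul_comm]
      congr 1
      rcases e1 with e1 | e1
      · rw [e1, ← Real.cosh_neg]
        ring_nf
      · rw [e1]
        ring_nf)
  simp_rw [(hst _).2] at hlim
  exact tendsto_nhds_unique hlim tendsto_const_nhds
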